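/- Let $Q_1=(-1,1)^n\subset\mathbb{R}^n$ and $\Gamma = Q_1\cap\{x_n=0\}$. Let $0<\varepsilon\le 1/2$ and let $w:Q_1\to\mathbb{R}$ be Lipschitz with $|w|\le 1$ and $|\nabla w(x)|\le \min\{1/\varepsilon, 1/|x_n|\}$ for almost every $x\in Q_1$. Then $\|w\|_{L^2(Q_1)}^2 + \int_{Q_1}\int_{Q_1}\frac{|w(x)-w(\bar x)|^2}{|x-\bar x|^{n+1}}\,dx\,d\bar x \le C|\log\varepsilon|$, where $C$ depends only on $n$. -/

import Mathlib

open MeasureTheory Real Set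

/-- The open unit cube `(-1,1)^d`. -/
def unitCube (d : ℕ) : Set (EuclideanSpace ℝ (Fin d)) := {x | ∀ i, |x i| < 1}

lemma lip_of_ae {E : Type*} [NormedAddCommGroup E] [NormedSpace ℝ E] [FiniteDimensional ℝ E]
    [MeasurableSpace E] [BorelSpace E] (μ : Measure E) [μ.IsAddHaarMeasure]
    {U : Set E} (hU : IsOpen U) (hc : Convex ℝ U) {w : E → ℝ} {L : NNReal}
    (hL : LipschitzOnWith L w U) {M : ℝ} (h : ∀ᵐ x ∂μ, x ∈ U → ‖fderiv ℝ w x‖ ≤ M)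
    {x y : E} (hx : x ∈ U) (hy : y ∈ U) : |w y - w x| ≤ M * ‖y - x‖ := by
  have h1 : ∀ᵐ z ∂μ, z ∈ U → DifferentiableAt ℝ w z ∧ ‖fderiv ℝ w z‖ ≤ M := by
    filter_upwards [h, hL.ae_differentiableWithinAt_of_mem (μ := μ)] with z h1 h2 hz
    exact ⟨(h2 hz).differentiableAt (hU.mem_nhds hz), h1 hz⟩
  obtain ⟨T, hT, hTm, hT0⟩ := exists_measurable_superset_of_null (ae_iff.1 h1)
  have hG : ∀ z, z ∉ T → z ∈ U → DifferentiableAt ℝ w z ∧ ‖fderiv ℝ w z‖ ≤ M := by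
    intro z hz
    by_contra hh
    exact hz (hT hh)
  have h2 : ∀ᵐ t : ℝ, ∀ᵐ k ∂μ, k + (x + t • (y - x)) ∉ T := by
    refine Filter.Eventually.of_forall fun t => ?_
    have : ∀ᵐ z ∂μ, z ∉ T := by rw [ae_iff]; simpa using hT0
    exact (measurePreserving_add_right μ (x + t • (y - x))).quasiMeasurePreserving.ae this
  have hmeas : MeasurableSet {p : ℝ × E | p.2 + (x + p.1 • (y - x)) ∉ T} := by
    have : Measurable fun p : ℝ × E => p.2 + (x + p.1 • (y - x)) := by fun_prop
    exact this hTm.compl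
  rw [Measure.ae_ae_comm hmeas] at h2
  have hP : ∀ᵐ k ∂μ, k + x ∈ U → k + y ∈ U → |w (k + y) - w (k + x)| ≤ M * ‖y - x‖ := by
    filter_upwards [h2] with k hk kx ky
    set γ : ℝ → E := fun t => k + (x + t • (y - x)) with hγ
    have hγU : ∀ t ∈ Icc (0:ℝ) 1, γ t ∈ U := by
      intro t ht
      have := hc kx ky (sub_nonneg.2 ht.2) ht.1 (by ring)
      convert this using 1
      simp only [hγ]; module
    have hγL : LipschitzOnWith ‖y - x‖₊ γ (uIcc 0 1) := by
      apply LipschitzWith.lipschitzOnWith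
      apply LipschitzWith.of_dist_le_mul
      intro s t
      have : γ s - γ t = (s - t) • (y - x) := by simp only [hγ]; module
      rw [dist_eq_norm, this, norm_smul, Real.dist_eq, Real.norm_eq_abs, mul_comm]; rfl
    have hcomp : LipschitzOnWith (L * ‖y - x‖₊) (w ∘ γ) (uIcc 0 1) := by
      refine hL.comp hγL ?_
      intro t ht
      rw [uIcc_of_le zero_le_one] at ht
      exact hγU t ht
    have hF := hcomp.absolutelyContinuousOnInterval.integral_deriv_eq_sub
    have h0 : γ 0 = k + x := by simp [hγ]
    have h1' : γ 1 = k + y := by simp [hγ]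
    simp only [Function.comp, h0, h1'] at hF
    rw [← hF, ← Real.norm_eq_abs]
    have := intervalIntegral.norm_integral_le_of_norm_le_const_ae (a := 0) (b := 1)
      (f := deriv fun t => w (γ t)) (C := M * ‖y - x‖) ?_
    · simp only [sub_zero, abs_one, mul_one] at this; exact this
    · filter_upwards [hk] with t ht ht'
      rw [uIoc_of_le zero_le_one] at ht'
      obtain ⟨hd, hn⟩ := hG _ ht (hγU t ⟨ht'.1.le, ht'.2⟩)
      have hγd : HasDerivAt γ (y - x) t := by
        have := (((hasDerivAt_id t).smul_const (y - x)).const_add x).const_add k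
        simp only [one_smul] at this; exact this
      have hd2 := (hd.hasFDerivAt (x := γ t)).comp_hasDerivAt t hγd
      have := hd2.deriv
      simp only [Function.comp_def] at this
      rw [this]
      exact ((fderiv ℝ w (γ t)).le_opNorm _).trans (by gcongr)
  have hdense := Measure.dense_of_ae hP
  have hfr := mem_closure_iff_frequently.1 (hdense 0)
  have cx : Filter.Tendsto (fun k : E => k + x) (nhds 0) (nhds x) := by
    have : Continuous fun k : E => k + x := by fun_prop
    simpa using this.tendsto 0
  have cy : Filter.Tendsto (fun k : E => k + y) (nhds 0) (nhds y) := by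
    have : Continuous fun k : E => k + y := by fun_prop
    simpa using this.tendsto 0
  have wx := (hL.continuousOn.continuousAt (hU.mem_nhds hx)).tendsto.comp cx
  have wy := (hL.continuousOn.continuousAt (hU.mem_nhds hy)).tendsto.comp cy
  refine le_of_tendsto_of_frequently (wy.sub wx).abs ?_
  refine (hfr.and_eventually ((cx.eventually (hU.mem_nhds hx)).and
    (cy.eventually (hU.mem_nhds hy)))).mono ?_
  rintro k ⟨h1, h2, h3⟩
  exact h1 h2 h3

lemma kernel_int (n : ℕ) : ∃ K > 0, ∀ r : ℝ, 0 < r →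
    Integrable (fun z : EuclideanSpace ℝ (Fin (n + 1)) => 32 / (‖z‖ ^ n * (r ^ 2 + ‖z‖ ^ 2))) ∧
    ∫ z : EuclideanSpace ℝ (Fin (n + 1)), 32 / (‖z‖ ^ n * (r ^ 2 + ‖z‖ ^ 2)) ≤ K / r := by
  set c : ℝ := (n + 1) * (volume : Measure (EuclideanSpace ℝ (Fin (n + 1)))).real (Metric.ball 0 1)
    with hc
  have hc0 : 0 ≤ c := by positivity
  refine ⟨c * (16 * π) + 1, by positivity, fun r hr => ?_⟩
  have key : ∀ y ∈ Ioi (0:ℝ), y ^ n • (32 / (y ^ n * (r ^ 2 + y ^ 2))) =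
      32 / r ^ 2 * (1 + (r⁻¹ * y) ^ 2)⁻¹ := by
    intro y hy
    have : (0:ℝ) < y := hy
    rw [smul_eq_mul]
    field_simp
  have hdim : Module.finrank ℝ (EuclideanSpace ℝ (Fin (n + 1))) - 1 = n := by simp
  have hI : Integrable fun y : ℝ => 32 / r ^ 2 * (1 + (r⁻¹ * y) ^ 2)⁻¹ :=
    (integrable_inv_one_add_sq.comp_mul_left' (inv_ne_zero hr.ne')).const_mul _
  constructor
  · rw [integrable_fun_norm_addHaar volume (f := fun y => 32 / (y ^ n * (r ^ 2 + y ^ 2))), hdim,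
      integrableOn_congr_fun key measurableSet_Ioi]
    exact hI.integrableOn
  · rw [integral_fun_norm_addHaar volume (fun y => 32 / (y ^ n * (r ^ 2 + y ^ 2))), hdim,
      setIntegral_congr_fun measurableSet_Ioi key, integral_const_mul,
      integral_comp_mul_left_Ioi (fun y => (1 + y ^ 2)⁻¹) 0 (inv_pos.2 hr)]
    simp only [mul_zero, integral_Ioi_inv_one_add_sq, arctan_zero, finrank_euclideanSpace,
      Fintype.card_fin, nsmul_eq_mul, smul_eq_mul, inv_inv]
    have : ((n + 1 : ℕ) : ℝ) * ((volume : Measure (EuclideanSpace ℝ (Fin (n + 1)))).real (Metric.ball 0 1) *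
      (32 / r ^ 2 * (r * (π / 2 - 0)))) = c * (16 * π) / r := by
      rw [hc]; push_cast; field_simp; ring
    rw [this]
    gcongr; linarith

lemma one_dim {ε : ℝ} (h0 : 0 < ε) (h1 : ε ≤ 1 / 2) :
    ∫ t in Ioo (-1:ℝ) 1, 1 / max ε |t| = 2 * (1 + |Real.log ε|) := by
  have e1 : ∫ t in Ioo (-1:ℝ) 1, 1 / max ε |t| =
      ∫ t, (fun s => (Iio (1:ℝ)).indicator (fun s => 1 / max ε s) s) |t| := by
    rw [← integral_indicator measurableSet_Ioo]
    congr 1; ext t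
    simp only [indicator, mem_Ioo, mem_Iio, abs_lt]
  have cont : Continuous fun s : ℝ => 1 / max ε s := by
    refine continuous_const.div (by fun_prop) fun s => ?_
    have : ε ≤ max ε s := le_max_left _ _
    linarith
  rw [e1, integral_comp_abs, setIntegral_indicator measurableSet_Iio, Ioi_inter_Iio,
    ← integral_Ioc_eq_integral_Ioo, ← intervalIntegral.integral_of_le zero_le_one,
    ← intervalIntegral.integral_add_adjacent_intervals (b := ε)
      (cont.intervalIntegrable _ _) (cont.intervalIntegrable _ _)]
  have i1 : ∫ s in (0:ℝ)..ε, 1 / max ε s = 1 := by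
    rw [intervalIntegral.integral_congr (g := fun _ => 1 / ε)]
    · simp [h0.ne']
    · intro s hs
      rw [uIcc_of_le h0.le] at hs
      simp only [max_eq_left hs.2]
  have i2 : ∫ s in ε..1, 1 / max ε s = - Real.log ε := by
    rw [intervalIntegral.integral_congr (g := fun s => 1 / s)]
    · rw [integral_one_div_of_pos h0 one_pos]; simp
    · intro s hs
      rw [uIcc_of_le (by linarith)] at hs
      simp only [max_eq_right hs.1]
  rw [i1, i2, abs_of_nonpos (Real.log_nonpos h0.le (by linarith))]

lemma cube_pre (d : ℕ) : unitCube d =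
    (@WithLp.ofLp 2 (Fin d → ℝ)) ⁻¹' (univ.pi fun _ => Ioo (-1:ℝ) 1) := by
  ext x; simp [unitCube, abs_lt]

lemma cube_int (n : ℕ) (g : ℝ → ℝ) :
    ∫ x in unitCube (n + 1), g (x (Fin.last n)) = 2 ^ n * ∫ t in Ioo (-1:ℝ) 1, g t := by
  have := (PiLp.volume_preserving_ofLp (Fin (n+1))).setIntegral_preimage_emb
    (MeasurableEquiv.toLp 2 (Fin (n+1) → ℝ)).symm.measurableEmbedding
    (fun x : Fin (n+1) → ℝ => g (x (Fin.last n))) (univ.pi fun _ => Ioo (-1:ℝ) 1)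
  rw [cube_pre, this, volume_pi, Measure.restrict_pi_pi]
  have h2 := integral_fin_nat_prod_eq_prod (n := n + 1)
    (μ := fun _ => (volume : Measure ℝ).restrict (Ioo (-1:ℝ) 1))
    (fun i t => if i = Fin.last n then g t else (1:ℝ))
  rw [Fin.prod_univ_castSucc] at h2
  simp only [Fin.prod_univ_castSucc, Fin.castSucc_ne_last, if_false, if_true, Finset.prod_const_one,
    one_mul] at h2
  rw [h2]
  congr 1
  simp
  norm_num

lemma cube_open (d : ℕ) : IsOpen (unitCube d) := by
  rw [cube_pre]
  exact (isOpen_set_pi finite_univ fun _ _ => isOpen_Ioo).preimage (PiLp.continuous_ofLp 2 _)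

lemma cube_convex (d : ℕ) : Convex ℝ (unitCube d) := by
  intro x hx y hy a b ha hb hab i
  have := convex_Ioo (-1:ℝ) 1 (abs_lt.1 (hx i)) (abs_lt.1 (hy i)) ha hb hab
  exact abs_lt.2 (by simpa using this)

lemma cube_fin (d : ℕ) : volume (unitCube d) < ⊤ := by
  rw [cube_pre, (PiLp.volume_preserving_ofLp (Fin d)).measure_preimage
    (MeasurableSet.univ_pi fun _ => measurableSet_Ioo).nullMeasurableSet, volume_pi, Measure.pi_pi]
  exact ENNReal.prod_lt_top (fun i _ => by simp)

lemma cube_int_one (n : ℕ) : ∫ x in unitCube (n + 1), (1:ℝ) = 2 ^ (n + 1) := by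
  rw [cube_int n fun _ => 1]
  simp; norm_num [pow_succ]

lemma ptwise (n : ℕ) {ε : ℝ} (h0 : 0 < ε) {L : NNReal} {w : EuclideanSpace ℝ (Fin (n + 1)) → ℝ}
    (hL : LipschitzOnWith L w (unitCube (n + 1)))
    (hb : ∀ x ∈ unitCube (n + 1), |w x| ≤ 1)
    (hg : ∀ᵐ x : EuclideanSpace ℝ (Fin (n + 1)), x ∈ unitCube (n + 1) →
          ‖fderiv ℝ w x‖ ≤ min (1 / ε) (1 / |x (Fin.last n)|))
    {x y : EuclideanSpace ℝ (Fin (n + 1))} (hx : x ∈ unitCube (n + 1)) (hy : y ∈ unitCube (n + 1)) :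
    |w x - w y| ≤ 2 ∧ |w x - w y| ≤ 4 * ‖x - y‖ / max ε |x (Fin.last n)| := by
  have h2 : |w x - w y| ≤ 2 := by
    have := abs_le.1 (hb x hx)
    have := abs_le.1 (hb y hy)
    rw [abs_le]; constructor <;> linarith
  refine ⟨h2, ?_⟩
  set r := max ε |x (Fin.last n)| with hr
  have hr0 : 0 < r := lt_max_of_lt_left h0
  rw [le_div_iff₀ hr0]
  rcases le_or_gt (r / 2) ‖x - y‖ with h | h
  · nlinarith
  · have hgV : ∀ᵐ z : EuclideanSpace ℝ (Fin (n + 1)), z ∈ unitCube (n + 1) ∩ Metric.ball x (r / 2) →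
        ‖fderiv ℝ w z‖ ≤ 2 / r := by
      filter_upwards [hg] with z hz hzV
      refine (hz hzV.1).trans ?_
      rcases le_total |x (Fin.last n)| ε with hh | hh
      · refine (min_le_left _ _).trans ?_
        rw [hr, max_eq_left hh]
        gcongr; norm_num
      · refine (min_le_right _ _).trans ?_
        have hre : r = |x (Fin.last n)| := by rw [hr, max_eq_right hh]
        have h3 : |x (Fin.last n) - z (Fin.last n)| ≤ ‖x - z‖ := by
          have := PiLp.norm_apply_le (x - z) (Fin.last n)
          simpa using this
        have h4 : ‖x - z‖ < r / 2 := by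
          have := hzV.2
          rwa [Metric.mem_ball, dist_comm, dist_eq_norm] at this
        have h5 := abs_sub_abs_le_abs_sub (x (Fin.last n)) (z (Fin.last n))
        have h6 : r / 2 ≤ |z (Fin.last n)| := by linarith
        calc 1 / |z (Fin.last n)| ≤ 1 / (r / 2) := by gcongr
          _ = 2 / r := by field_simp
    have := lip_of_ae volume ((cube_open (n+1)).inter Metric.isOpen_ball)
      ((cube_convex (n+1)).inter (convex_ball _ _)) (hL.mono inter_subset_left) hgV
      (x := y) (y := x) ⟨hy, by rwa [Metric.mem_ball, dist_comm, dist_eq_norm]⟩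
      ⟨hx, Metric.mem_ball_self (by linarith)⟩
    have h7 : 2 / r * ‖x - y‖ * r = 2 * ‖x - y‖ := by field_simp
    have h8 := mul_le_mul_of_nonneg_right this hr0.le
    have := norm_nonneg (x - y)
    linarith

lemma integrand_le (n : ℕ) {a s r : ℝ} (hr : 0 < r) (hs : 0 ≤ s) (ha : 0 ≤ a) (h1 : a ≤ 2)
    (h2 : a ≤ 4 * s / r) : a ^ 2 / s ^ (n + 2) ≤ 32 / (s ^ n * (r ^ 2 + s ^ 2)) := by
  rcases hs.eq_or_lt with rfl | hs
  · simp; positivity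
  · rw [div_le_div_iff₀ (by positivity) (by positivity)]
    have key : a ^ 2 * (r ^ 2 + s ^ 2) ≤ 32 * s ^ 2 := by
      rw [le_div_iff₀ hr] at h2
      have h3 : a ^ 2 * r ^ 2 ≤ 16 * s ^ 2 := by
        have := pow_le_pow_left₀ (by positivity) h2 2
        nlinarith
      have h4 : a ^ 2 ≤ 4 := by nlinarith
      nlinarith [sq_nonneg s]
    calc a ^ 2 * (s ^ n * (r ^ 2 + s ^ 2)) = s ^ n * (a ^ 2 * (r ^ 2 + s ^ 2)) := by ring
      _ ≤ s ^ n * (32 * s ^ 2) := by gcongr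
      _ = 32 * s ^ (n + 2) := by ring

/-- Key `H^{1/2}` estimate on the cube: a bounded Lipschitz function whose gradient is
bounded by `min{1/ε, 1/|x_n|}` has `H^{1/2}` norm squared at most `C |log ε|`. -/
theorem stmt5 (n : ℕ) :
    ∃ C > 0, ∀ ε : ℝ, 0 < ε → ε ≤ 1 / 2 →
      ∀ (L : NNReal) (w : EuclideanSpace ℝ (Fin (n + 1)) → ℝ),
        LipschitzOnWith L w (unitCube (n + 1)) →
        (∀ x ∈ unitCube (n + 1), |w x| ≤ 1) →
        (∀ᵐ x : EuclideanSpace ℝ (Fin (n + 1)), x ∈ unitCube (n + 1) →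
          ‖fderiv ℝ w x‖ ≤ min (1 / ε) (1 / |x (Fin.last n)|)) →
        (∫ x in unitCube (n + 1), (w x) ^ 2) +
          (∫ x in unitCube (n + 1), ∫ y in unitCube (n + 1),
            |w x - w y| ^ 2 / ‖x - y‖ ^ (n + 2)) ≤ C * |Real.log ε| := by
  obtain ⟨K, hK, hKr⟩ := kernel_int n
  refine ⟨2 ^ (n + 1) * 2 + K * 2 ^ (n + 1) * 3, by positivity, ?_⟩
  intro ε h0 h1 L w hL hb hg
  have hQm : MeasurableSet (unitCube (n + 1)) := (cube_open (n + 1)).measurableSet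
  have hfin : volume (unitCube (n + 1)) ≠ ⊤ := (cube_fin (n + 1)).ne
  have hlog : 1 / 2 ≤ |Real.log ε| := by
    rw [abs_of_nonpos (Real.log_nonpos h0.le (by linarith))]
    have := Real.log_le_log h0 h1
    rw [one_div, Real.log_inv] at this
    have := Real.log_two_gt_d9
    linarith
  have I1 : ∫ x in unitCube (n + 1), (w x) ^ 2 ≤ 2 ^ (n + 1) := by
    rw [← cube_int_one n]
    refine integral_mono_of_nonneg (Filter.Eventually.of_forall fun x => sq_nonneg _)
      (integrableOn_const hfin) ?_
    filter_upwards [ae_restrict_mem hQm] with x hx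
    exact (sq_le_one_iff_abs_le_one _).2 (hb x hx)
  have I2 : (∫ x in unitCube (n + 1), ∫ y in unitCube (n + 1),
      |w x - w y| ^ 2 / ‖x - y‖ ^ (n + 2)) ≤
      ∫ x in unitCube (n + 1), K * (1 / max ε |x (Fin.last n)|) := by
    refine integral_mono_of_nonneg
      (Filter.Eventually.of_forall fun x => integral_nonneg fun y => by positivity) ?_ ?_
    · refine Measure.integrableOn_of_bounded (M := K * (1 / ε)) hfin ?_ ?_
      · apply Continuous.aestronglyMeasurable
        refine continuous_const.mul (continuous_const.div (by fun_prop) fun x => ?_)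
        exact (lt_max_of_lt_left h0).ne'
      · refine Filter.Eventually.of_forall fun x => ?_
        have : 0 < max ε |x (Fin.last n)| := lt_max_of_lt_left h0
        rw [Real.norm_of_nonneg (by positivity)]
        gcongr
        exact le_max_left _ _
    · filter_upwards [ae_restrict_mem hQm] with x hx
      have hr : 0 < max ε |x (Fin.last n)| := lt_max_of_lt_left h0
      obtain ⟨hi, hle⟩ := hKr _ hr
      have hi' := hi.comp_sub_left x
      calc ∫ y in unitCube (n + 1), |w x - w y| ^ 2 / ‖x - y‖ ^ (n + 2)
          ≤ ∫ y in unitCube (n + 1),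
            32 / (‖x - y‖ ^ n * ((max ε |x (Fin.last n)|) ^ 2 + ‖x - y‖ ^ 2)) := by
            refine integral_mono_of_nonneg (Filter.Eventually.of_forall fun y => by positivity)
              hi'.integrableOn ?_
            filter_upwards [ae_restrict_mem hQm] with y hy
            obtain ⟨p1, p2⟩ := ptwise n h0 hL hb hg hx hy
            exact integrand_le n hr (norm_nonneg _) (abs_nonneg _) p1 p2
        _ ≤ ∫ y, 32 / (‖x - y‖ ^ n * ((max ε |x (Fin.last n)|) ^ 2 + ‖x - y‖ ^ 2)) :=
            setIntegral_le_integral hi' (Filter.Eventually.of_forall fun y => by positivity)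
        _ = ∫ z : EuclideanSpace ℝ (Fin (n + 1)),
              32 / (‖z‖ ^ n * ((max ε |x (Fin.last n)|) ^ 2 + ‖z‖ ^ 2)) :=
            integral_sub_left_eq_self (fun z : EuclideanSpace ℝ (Fin (n + 1)) =>
              32 / (‖z‖ ^ n * ((max ε |x (Fin.last n)|) ^ 2 + ‖z‖ ^ 2))) volume x
        _ ≤ K / max ε |x (Fin.last n)| := hle
        _ = K * (1 / max ε |x (Fin.last n)|) := by ring
  rw [cube_int n (fun t => K * (1 / max ε |t|)), integral_const_mul, one_dim h0 h1] at I2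
  have e : (2:ℝ) ^ n * (K * (2 * (1 + |Real.log ε|))) = K * 2 ^ (n + 1) * (1 + |Real.log ε|) := by
    ring
  rw [e] at I2
  have P1 : (0:ℝ) < 2 ^ (n + 1) := by positivity
  have P2 : (0:ℝ) < K * 2 ^ (n + 1) := by positivity
  nlinarith
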